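/- For integers n ≥ 0 and g ≥ 0, let h_g(n) = #{ζ : ζ is an (n+1)-cycle in S_{n+1} and the permutation x ↦ ζ(ρ_{n+1}(x)) has exactly n+1−2g cycles} (so h_g(n) = 0 whenever 2g > n), and set h_{−1}(n) = 0 for all n. Then for all n ≥ 2 and g ≥ 0, (n+2)·h_g(n) + (n−1)·h_g(n−2) = (2n+1)·h_g(n−1) + n²(n−1)·h_{g−1}(n−2). -/

import Mathlib

open Finset Polynomial

/-- Number of cycles of a permutation, counting fixed points as cycles of length 1
(equivalently, the number of orbits). -/
noncomputable def cycleCount {α : Type*} [Fintype α] [DecidableEq α] (σ : Equiv.Perm α) : ℕ :=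
  σ.cycleType.card + (Finset.univ.filter fun x => σ x = x).card

/-- The IO-polynomial `F_π(z) = Σ_{ζ ∈ Q_n} z^⌊(c(ζπ)-1)/2⌋`, where `Q_n` is the set of
`n`-cycles of `S_n` (i.e. permutations with a single cycle), and `ζπ` applies `ζ` first
and then `π`. -/
noncomputable def IOPoly {n : ℕ} (π : Equiv.Perm (Fin n)) : Polynomial ℝ :=
  ∑ ζ ∈ Finset.univ.filter (fun ζ : Equiv.Perm (Fin n) => cycleCount ζ = 1),
    Polynomial.X ^ ((cycleCount (π * ζ) - 1) / 2)
/-- The Hultman number `h_g(n)`: the number of `(n+1)`-cycles `ζ` in `S_{n+1}` such that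
the permutation `x ↦ ζ(ρ_{n+1}(x))` has exactly `n + 1 - 2g` cycles.  For `g < 0` (and
for `2g > n`) this count is `0`. -/
noncomputable def hultman (n : ℕ) (g : ℤ) : ℕ :=
  (Finset.univ.filter (fun ζ : Equiv.Perm (Fin (n + 1)) =>
    cycleCount ζ = 1 ∧ (cycleCount (ζ * finRotate (n + 1)) : ℤ) = (n : ℤ) + 1 - 2 * g)).card

open Equiv Equiv.Perm

section CycleCount

variable {α β : Type*} [Fintype α] [DecidableEq α] [Fintype β] [DecidableEq β]

theorem cycleCount_add_card_support (σ : Perm α) :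
    cycleCount σ + #σ.support = σ.cycleType.card + Fintype.card α := by
  have h : (univ.filter fun x => σ x = x) = σ.supportᶜ := by ext; simp
  have := Finset.card_add_card_compl σ.support
  rw [cycleCount, h]
  omega

theorem cycleCount_conj (τ σ : Perm α) : cycleCount (τ * σ * τ⁻¹) = cycleCount σ := by
  have h₁ := cycleCount_add_card_support (τ * σ * τ⁻¹)
  have h₂ := cycleCount_add_card_support σ
  rw [← sum_cycleType, cycleType_conj, sum_cycleType] at h₁
  omega

theorem cycleCount_inv (σ : Perm α) : cycleCount σ⁻¹ = cycleCount σ := by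
  have h₁ := cycleCount_add_card_support σ⁻¹
  have h₂ := cycleCount_add_card_support σ
  rw [support_inv, cycleType_inv] at h₁
  omega

theorem cycleCount_one : cycleCount (1 : Perm α) = Fintype.card α := by
  simp [cycleCount]

theorem cycleCount_extendDomain {p : β → Prop} [DecidablePred p] (f : α ≃ Subtype p)
    (σ : Perm α) :
    cycleCount (σ.extendDomain f) + Fintype.card α = cycleCount σ + Fintype.card β := by
  have h₁ := cycleCount_add_card_support (σ.extendDomain f)
  have h₂ := cycleCount_add_card_support σ
  rw [card_support_extend_domain, cycleType_extendDomain] at h₁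
  omega

theorem cycleCount_optionCongr (σ : Perm α) :
    cycleCount (optionCongr σ) = cycleCount σ + 1 := by
  have h : optionCongr σ = σ.extendDomain (optionIsSomeEquiv α).symm := by
    ext1 x
    cases x with
    | none => exact (extendDomain_apply_not_subtype _ _ (by simp)).symm
    | some a => exact (extendDomain_apply_image σ (optionIsSomeEquiv α).symm a).symm
  have := cycleCount_extendDomain (optionIsSomeEquiv α).symm σ
  rw [← h, Fintype.card_option] at this
  omega

theorem cycleCount_permCongr (e : α ≃ β) (σ : Perm α) :
    cycleCount (e.permCongr σ) = cycleCount σ := by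
  let f : α ≃ {_x : β // True} := e.trans (Equiv.subtypeUnivEquiv fun _ => trivial).symm
  have h : e.permCongr σ = σ.extendDomain f := by
    ext1 x
    obtain ⟨a, rfl⟩ := e.surjective x
    rw [permCongr_apply, symm_apply_apply]
    exact (extendDomain_apply_image σ f a).symm
  have := cycleCount_extendDomain f σ
  rw [← h, Fintype.card_congr e] at this
  omega

theorem sign_eq_neg_one_pow (σ : Perm α) :
    sign σ = (-1) ^ (Fintype.card α + cycleCount σ) := by
  have h := cycleCount_add_card_support σ
  rw [sign_of_cycleType, sum_cycleType]
  have : Fintype.card α + cycleCount σ + 2 * #σ.support =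
      #σ.support + σ.cycleType.card + 2 * Fintype.card α := by omega
  have := congrArg (fun k => (-1 : ℤˣ) ^ k) this
  simpa [pow_add, pow_mul] using this.symm

theorem Equiv.Perm.IsCycle.card_support_swap_mul {f : Perm α} (hf : f.IsCycle) {x : α}
    (hx : f x ≠ x) :
    (swap x (f x) * f).cycleType.card + #f.support =
      #(swap x (f x) * f).support + 2 := by
  by_cases hxx : f (f x) = x
  · have h := hf.eq_swap_of_apply_apply_eq_self hx hxx
    have h2 : #f.support = 2 := by rw [h, card_support_swap hx.symm]
    have h1 : swap x (f x) * f = 1 := by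
      conv_lhs => rw [h]
      simp [swap_mul_self]
    rw [h1, h2]
    simp
  · rw [card_cycleType_eq_one.2 (hf.swap_mul hx hxx), support_swap_mul_eq f x hxx,
      sdiff_singleton_eq_erase, card_erase_of_mem (mem_support.2 hx)]
    have := hf.two_le_card_support
    omega

theorem cycleCount_swap_mul {σ : Perm α} {x : α} (hx : σ x ≠ x) :
    cycleCount (swap x (σ x) * σ) = cycleCount σ + 1 := by
  set f := σ.cycleOf x with hf
  have hfx : f x = σ x := cycleOf_apply_self σ x
  have hcyc : f.IsCycle := isCycle_cycleOf σ hx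
  have hmem : f ∈ σ.cycleFactorsFinset := cycleOf_mem_cycleFactorsFinset_iff.2 (mem_support.2 hx)
  have hd := (disjoint_mul_inv_of_mem_cycleFactorsFinset hmem).symm
  set τ := σ * f⁻¹ with hτ
  have hσ : σ = f * τ := by rw [hd.commute.eq, hτ, inv_mul_cancel_right]
  have hd' : Disjoint (swap x (f x) * f) τ := by
    intro y
    refine (hd y).imp_left fun h => ?_
    by_contra hy
    exact (ne_and_ne_of_swap_mul_apply_ne_self hy).1 h
  have h := hcyc.card_support_swap_mul (hfx ▸ hx)
  have h₁ := cycleCount_add_card_support (swap x (σ x) * σ)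
  have h₂ := cycleCount_add_card_support σ
  have hs : swap x (σ x) * σ = swap x (f x) * f * τ := by rw [hfx, mul_assoc, ← hσ]
  rw [hs, hd'.cycleType_mul, hd'.card_support_mul, Multiset.card_add, ← hs] at h₁
  rw [hσ, hd.cycleType_mul, hd.card_support_mul, Multiset.card_add, ← hσ,
    card_cycleType_eq_one.2 hcyc] at h₂
  omega

theorem cycleCount_mul_swap {σ : Perm α} {x y : α} (hxy : x ≠ y) (h : σ y = x) :
    cycleCount (σ * swap x y) = cycleCount σ + 1 := by
  have hx : σ x ≠ x := fun h' => hxy (σ.injective (h'.trans h.symm))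
  rw [mul_swap_eq_swap_mul, h, swap_comm, cycleCount_swap_mul hx]

end CycleCount

section DeletePoint

variable {α : Type*} [DecidableEq α] {s : Finset α} {w : Perm α} {p i j n : α}

/-- The permutation fixing `p` obtained from `σ` by deleting `p` from its cycle. -/
def deletePoint (p : α) (σ : Perm α) : Perm α :=
  swap p (σ p) * σ

theorem deletePoint_apply_self : deletePoint p w p = p := by
  simp [deletePoint]

theorem deletePoint_conj (τ : Perm α) :
    deletePoint (τ p) (τ * w * τ⁻¹) = τ * deletePoint p w * τ⁻¹ := by
  have h : (τ * w * τ⁻¹) (τ p) = τ (w p) := by simp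
  rw [deletePoint, deletePoint, h, ← mul_assoc, ← mul_assoc, ← mul_assoc, mul_swap_eq_swap_mul]

theorem deletePoint_inv : deletePoint p w⁻¹ = (deletePoint p w)⁻¹ := by
  have h : w⁻¹ (w p) = p := by simp
  rw [deletePoint, deletePoint, mul_inv_rev, swap_inv, mul_swap_eq_swap_mul, h, swap_comm]

theorem deletePoint_deletePoint_mul_swap (hwi : w i = n) (hin : i ≠ n) (hpi : p ≠ i)
    (hpn : p ≠ n) (hpj : p ≠ j) :
    deletePoint n (deletePoint p w) * swap i j = deletePoint p (deletePoint n w * swap i j) := by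
  have hinj := w.injective
  have h : deletePoint n (deletePoint p w) = deletePoint p (deletePoint n w) := by
    ext x
    simp only [deletePoint, mul_apply, swap_apply_def]
    grind [Function.Injective]
  rw [h]
  simp only [deletePoint, mul_apply, swap_apply_of_ne_of_ne hpi hpj, mul_assoc]

theorem map_swap_erase (hi : i ∈ s) (hj : j ∈ s) :
    (s.erase j).map (swap i j).toEmbedding = s.erase i := by
  ext x
  rw [mem_map_equiv, symm_swap, mem_erase, mem_erase, swap_apply_def]
  grind

end DeletePoint

section FullCycle

variable {α : Type*} [Fintype α] [DecidableEq α] {s : Finset α} {σ v w : Perm α} {p q i j : α}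

/-- `σ` fixes every point outside `s` and permutes `s` in a single cycle (for nonempty `s`). -/
def IsFullCycleOn (s : Finset α) (σ : Perm α) : Prop :=
  σ.support ⊆ s ∧ cycleCount σ + #s = Fintype.card α + 1

noncomputable instance (s : Finset α) (σ : Perm α) : Decidable (IsFullCycleOn s σ) :=
  inferInstanceAs (Decidable (_ ∧ _))

theorem card_lt_cycleCount_add_card (hs : s.Nonempty) (h : σ.support ⊆ s) :
    Fintype.card α < cycleCount σ + #s := by
  have h₁ := cycleCount_add_card_support σ
  have h₂ := card_le_card h
  by_cases h₃ : σ = 1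
  · have := hs.card_pos
    rw [h₃, cycleCount_one]
    omega
  · have := card_cycleType_pos.2 h₃
    omega

theorem IsFullCycleOn.apply_ne (h : IsFullCycleOn s σ) (hp : p ∈ s) (hs : 2 ≤ #s) : σ p ≠ p := by
  intro hσ
  have h₁ : σ.support ⊆ s.erase p := fun x hx =>
    mem_erase.2 ⟨fun hxp => mem_support.1 hx (hxp ▸ hσ), h.1 hx⟩
  have h₂ := card_erase_of_mem hp
  have h₃ := card_lt_cycleCount_add_card (card_pos.1 (by omega)) h₁
  have := h.2
  omega

theorem IsFullCycleOn.conj (τ : Perm α) (h : IsFullCycleOn s σ) :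
    IsFullCycleOn (s.map τ.toEmbedding) (τ * σ * τ⁻¹) := by
  refine ⟨?_, by rw [cycleCount_conj, card_map]; exact h.2⟩
  rw [support_conj]
  exact map_subset_map.2 h.1

theorem isFullCycleOn_inv : IsFullCycleOn s σ⁻¹ ↔ IsFullCycleOn s σ := by
  rw [IsFullCycleOn, IsFullCycleOn, support_inv, cycleCount_inv]

theorem support_mul_subset (hv : v.support ⊆ s) (hw : w.support ⊆ s) : (v * w).support ⊆ s :=
  (support_mul_le v w).trans (union_subset hv hw)

theorem support_swap_subset (hi : i ∈ s) (hj : j ∈ s) : (swap i j).support ⊆ s := by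
  intro x hx
  by_contra h
  exact mem_support.1 hx (swap_apply_of_ne_of_ne (by grind) (by grind))

theorem apply_mem_of_support_subset (hw : w.support ⊆ s) (hp : p ∈ s) : w p ∈ s := by
  by_cases h : w p = p
  · rwa [h]
  · exact hw (apply_mem_support.2 (mem_support.2 h))

theorem support_subset_erase (hw : w.support ⊆ s) (h : w p = p) : w.support ⊆ s.erase p :=
  fun _ hx => mem_erase.2 ⟨fun hxp => mem_support.1 hx (hxp ▸ h), hw hx⟩

theorem support_deletePoint_subset (hw : w.support ⊆ s) (hp : p ∈ s) :
    (deletePoint p w).support ⊆ s.erase p :=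
  support_subset_erase
    (support_mul_subset (support_swap_subset hp (apply_mem_of_support_subset hw hp)) hw)
    deletePoint_apply_self

theorem isFullCycleOn_erase_mul_swap (hp : p ∈ s) (hq : q ∈ s) (hpq : p ≠ q) (h : σ q = p) :
    IsFullCycleOn (s.erase p) (σ * swap p q) ↔ IsFullCycleOn s σ := by
  have h₁ := cycleCount_mul_swap hpq h
  have h₂ := card_erase_add_one hp
  have hsw := support_swap_subset hp hq
  refine ⟨fun hσ => ⟨?_, ?_⟩, fun hσ => ⟨?_, ?_⟩⟩
  · simpa [mul_assoc] using support_mul_subset (hσ.1.trans (erase_subset p s)) hsw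
  · have := hσ.2
    omega
  · exact support_subset_erase (support_mul_subset hσ.1 hsw) (by simp [h])
  · have := hσ.2
    omega

/-- The number of factorizations `v = ζ⁻¹ * η` into two full cycles on `s`. -/
noncomputable def fullCycleFactorizations (s : Finset α) (v : Perm α) : ℕ :=
  #{ζ : Perm α | IsFullCycleOn s ζ ∧ IsFullCycleOn s (ζ * v)}

theorem card_isFullCycleOn_erase (hs : 2 ≤ #s) (hw : w.support ⊆ s) (hp : p ∈ s) :
    #{ζ : Perm α | IsFullCycleOn s ζ ∧ IsFullCycleOn (s.erase p) (ζ * w)} =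
      if w p = p then 0 else fullCycleFactorizations (s.erase p) (deletePoint p w) := by
  have hfix {η : Perm α} (h : IsFullCycleOn (s.erase p) η) : η p = p := by
    by_contra hne
    exact notMem_erase p s (h.1 (mem_support.2 hne))
  split_ifs with hwp
  · refine card_eq_zero.2 (filter_eq_empty_iff.2 fun ζ _ hζ => hζ.1.apply_ne hp hs ?_)
    simpa [hwp] using hfix hζ.2
  have hq := apply_mem_of_support_subset hw hp
  refine card_nbij' (fun ζ => ζ * swap p (w p)) (fun ζ => ζ * swap p (w p)) ?_ ?_ ?_ ?_
  · intro ζ hζ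
    simp only [coe_filter, mem_univ, true_and, Set.mem_ofPred_eq] at hζ ⊢
    refine ⟨(isFullCycleOn_erase_mul_swap hp hq (Ne.symm hwp) (hfix hζ.2)).2 hζ.1, ?_⟩
    simpa [deletePoint, mul_assoc] using hζ.2
  · intro ζ hζ
    simp only [coe_filter, mem_univ, true_and, Set.mem_ofPred_eq] at hζ ⊢
    refine ⟨(isFullCycleOn_erase_mul_swap hp hq (Ne.symm hwp) ?_).1 ?_, ?_⟩
    · simpa using hfix hζ.1
    · simpa [mul_assoc] using hζ.1
    · simpa [deletePoint, mul_assoc] using hζ.2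
  · intro ζ _
    simp [mul_assoc]
  · intro ζ _
    simp [mul_assoc]

theorem fullCycleFactorizations_conj (τ : Perm α) (s : Finset α) (v : Perm α) :
    fullCycleFactorizations (s.map τ.toEmbedding) (τ * v * τ⁻¹) = fullCycleFactorizations s v := by
  symm
  refine card_nbij' (fun ζ => τ * ζ * τ⁻¹) (fun ζ => τ⁻¹ * ζ * τ) ?_ ?_ ?_ ?_
  · intro ζ hζ
    simp only [coe_filter, mem_univ, true_and, Set.mem_ofPred_eq] at hζ ⊢
    exact ⟨hζ.1.conj τ, by simpa [mul_assoc] using hζ.2.conj τ⟩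
  · intro ζ hζ
    simp only [coe_filter, mem_univ, true_and, Set.mem_ofPred_eq] at hζ ⊢
    have hs : (s.map τ.toEmbedding).map (τ⁻¹).toEmbedding = s := by
      ext x
      simp [mem_map_equiv, ← Perm.inv_def]
    have h₁ := hζ.1.conj τ⁻¹
    have h₂ := hζ.2.conj τ⁻¹
    rw [hs] at h₁ h₂
    exact ⟨by simpa using h₁, by simpa [mul_assoc] using h₂⟩
  · intro ζ _
    simp [mul_assoc]
  · intro ζ _
    simp [mul_assoc]

theorem fullCycleFactorizations_inv (s : Finset α) (v : Perm α) :
    fullCycleFactorizations s v⁻¹ = fullCycleFactorizations s v := by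
  refine card_nbij' (fun ζ => ζ * v⁻¹) (fun ζ => ζ * v) ?_ ?_ ?_ ?_ <;> intro ζ hζ
  · simpa [and_comm] using hζ
  · simpa [and_comm] using hζ
  · simp
  · simp

theorem fullCycleFactorizations_eq_sum (hs : 2 ≤ #s) (hv : v.support ⊆ s) (hi : i ∈ s) :
    fullCycleFactorizations s v = ∑ j ∈ s.erase i,
      if v j = i then 0
      else fullCycleFactorizations (s.erase i) (deletePoint i (v * swap i j)) := by
  rw [fullCycleFactorizations, card_eq_sum_card_fiberwise (f := fun ζ => (ζ * v)⁻¹ i)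
    (t := s.erase i)]
  · refine sum_congr rfl fun j hj => ?_
    obtain ⟨hji, hjs⟩ := mem_erase.1 hj
    have h := card_isFullCycleOn_erase hs
      (support_mul_subset hv (support_swap_subset hi hjs)) hi
    rw [mul_apply, swap_apply_left] at h
    rw [← h, filter_filter]
    congr 1
    refine filter_congr fun ζ _ => ?_
    rw [inv_eq_iff_eq, ← mul_assoc, and_assoc, and_congr_right_iff]
    intro _
    refine ⟨fun h => (isFullCycleOn_erase_mul_swap hi hjs hji.symm h.2.symm).2 h.1, fun h => ?_⟩
    have hji' : (ζ * v) j = i := by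
      by_contra hne
      refine notMem_erase i s (h.1 (mem_support.2 ?_))
      rwa [mul_apply _ (swap i j), swap_apply_left]
    exact ⟨(isFullCycleOn_erase_mul_swap hi hjs hji.symm hji').1 h, hji'.symm⟩
  · intro ζ hζ
    simp only [coe_filter, mem_univ, true_and, Set.mem_ofPred_eq] at hζ
    have h := isFullCycleOn_inv.2 hζ.2
    exact mem_erase.2 ⟨h.apply_ne hi hs, apply_mem_of_support_subset h.1 hi⟩

theorem fullCycleFactorizations_eq_sum_left (hs : 2 ≤ #s) (hv : v.support ⊆ s) (hi : i ∈ s) :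
    fullCycleFactorizations s v = ∑ j ∈ s.erase i,
      if v i = j then 0
      else fullCycleFactorizations (s.erase i) (deletePoint i (swap i j * v)) := by
  rw [← fullCycleFactorizations_inv,
    fullCycleFactorizations_eq_sum hs (by rwa [support_inv]) hi]
  refine sum_congr rfl fun j _ => ?_
  rw [← fullCycleFactorizations_inv _ (deletePoint i (swap i j * v)), ← deletePoint_inv,
    mul_inv_rev, swap_inv]
  have h : v⁻¹ j = i ↔ v i = j := by rw [inv_eq_iff_eq, eq_comm]
  simp only [h]

theorem fullCycleFactorizations_eq_sum_pred (hs : 2 ≤ #s) (hv : v.support ⊆ s) (hp : p ∈ s)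
    (hvi : v i = p) (hip : i ≠ p) :
    fullCycleFactorizations s v = ∑ j ∈ (s.erase p).erase i,
      fullCycleFactorizations (s.erase p) (deletePoint p v * swap i j) := by
  have his : i ∈ s.erase p :=
    mem_erase.2 ⟨hip, hv (mem_support.2 fun h => hip (h.symm.trans hvi))⟩
  rw [fullCycleFactorizations_eq_sum hs hv hp, ← add_sum_erase _ _ his, if_pos hvi, zero_add]
  refine sum_congr rfl fun j hj => ?_
  obtain ⟨hji, hj'⟩ := mem_erase.1 hj
  obtain ⟨hjp, hjs⟩ := mem_erase.1 hj'
  have hvj : v j ≠ p := fun h => hji (v.injective (h.trans hvi.symm))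
  rw [if_neg hvj]
  congr 1
  ext x
  have hinj := v.injective
  simp only [deletePoint, mul_apply, swap_apply_def]
  grind [Function.Injective]

/-- The number of triples `(p, ζ, η)` with `w = ζ⁻¹ * η`, where `ζ` is a full cycle on `s` and
`η` is a full cycle on `s.erase p`. -/
noncomputable def nearFullCycleFactorizations (s : Finset α) (w : Perm α) : ℕ :=
  ∑ p ∈ s, if w p = p then 0 else fullCycleFactorizations (s.erase p) (deletePoint p w)

theorem nearFullCycleFactorizations_eq_sum {n : α} (hs : 3 ≤ #s) (hw : w.support ⊆ s)
    (hn : n ∈ s) (hwi : w i = n) (hin : i ≠ n) :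
    nearFullCycleFactorizations s w = ∑ j ∈ (s.erase n).erase i,
      nearFullCycleFactorizations (s.erase n) (deletePoint n w * swap i j) := by
  have his : i ∈ s := hw (mem_support.2 fun h => hin (h.symm.trans hwi))
  have hwn : w n ≠ n := fun h => hin (w.injective (hwi.trans h.symm))
  have hwi' : w i ≠ i := fun h => hin (h.symm.trans hwi)
  have hcard := card_erase_add_one hn
  set S := s.erase n with hS
  set u := deletePoint n w with hu
  have hiS : i ∈ S := mem_erase.2 ⟨hin, his⟩
  have hS2 : 2 ≤ #S := by omega
  have huS : u.support ⊆ S := support_deletePoint_subset hw hn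
  have hconj : fullCycleFactorizations (s.erase i) (deletePoint i w) =
      fullCycleFactorizations S u := by
    rw [← fullCycleFactorizations_conj (swap n i), map_swap_erase hn his]
    congr 1
    rw [deletePoint, hwi, swap_comm i n, swap_inv, swap_mul_self_mul, mul_swap_eq_swap_mul, hwi,
      hu, deletePoint, swap_comm]
  have hp : ∀ p ∈ S.erase i,
      (if w p = p then 0 else fullCycleFactorizations (s.erase p) (deletePoint p w)) =
        ∑ j ∈ (S.erase i).erase p, if w p = p then 0 else
          fullCycleFactorizations (S.erase p) (deletePoint p (u * swap i j)) := by
    intro p hp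
    obtain ⟨hpi, hpS⟩ := mem_erase.1 hp
    obtain ⟨hpn, hps⟩ := mem_erase.1 hpS
    split_ifs with hwp
    · simp
    have hcard' := card_erase_add_one hps
    have hdi : deletePoint p w i = n := by
      rw [deletePoint, mul_apply, hwi, swap_apply_of_ne_of_ne hpn.symm]
      rintro rfl
      exact hpi (w.injective hwi).symm
    rw [fullCycleFactorizations_eq_sum_pred (by omega) (support_deletePoint_subset hw hps)
      (mem_erase.2 ⟨hpn.symm, hn⟩) hdi hin, erase_right_comm (a := p), ← hS,
      erase_right_comm (a := p)]
    refine sum_congr rfl fun j hj => ?_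
    rw [deletePoint_deletePoint_mul_swap hwi hin hpi hpn (mem_erase.1 hj).1.symm]
  have hj : ∀ j ∈ S.erase i, nearFullCycleFactorizations S (u * swap i j) =
      (if u j = i then 0 else fullCycleFactorizations (S.erase i) (deletePoint i (u * swap i j))) +
      ((if u i = j then 0 else
        fullCycleFactorizations (S.erase i) (deletePoint i (swap i j * u))) +
      ∑ p ∈ (S.erase i).erase j, if w p = p then 0 else
          fullCycleFactorizations (S.erase p) (deletePoint p (u * swap i j))) := by
    intro j hj
    obtain ⟨hji, hjS⟩ := mem_erase.1 hj
    rw [nearFullCycleFactorizations, ← add_sum_erase _ _ hiS, ← add_sum_erase _ _ hj]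
    congr 2
    · rw [mul_apply, swap_apply_left]
    · rw [mul_apply, swap_apply_right]
      congr 1
      rw [← fullCycleFactorizations_conj (swap i j), map_swap_erase hiS hjS, ← deletePoint_conj,
        swap_apply_right, swap_inv, mul_assoc, mul_assoc, swap_mul_self, mul_one]
    · refine sum_congr rfl fun p hp => ?_
      obtain ⟨hpj, hp'⟩ := mem_erase.1 hp
      obtain ⟨hpi, hpS⟩ := mem_erase.1 hp'
      have hpn := (mem_erase.1 hpS).1
      have hiff : (u * swap i j) p = p ↔ w p = p := by
        rw [mul_apply, swap_apply_of_ne_of_ne hpi hpj, hu, deletePoint, mul_apply]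
        have hinj := w.injective
        rw [swap_apply_def]
        grind [Function.Injective]
      simp only [hiff]
  rw [sum_congr rfl hj, sum_add_distrib, sum_add_distrib,
    ← fullCycleFactorizations_eq_sum hS2 huS hiS, ← fullCycleFactorizations_eq_sum_left hS2 huS hiS,
    nearFullCycleFactorizations, ← add_sum_erase _ _ hn, ← add_sum_erase _ _ hiS, if_neg hwn,
    if_neg hwi', hconj, sum_congr rfl hp]
  congr 2
  refine sum_comm' fun p j => ?_
  simp only [mem_erase]
  tauto

theorem fullCycleFactorizations_singleton_one (p : α) :
    fullCycleFactorizations {p} (1 : Perm α) = 1 := by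
  rw [fullCycleFactorizations, card_eq_one]
  refine ⟨1, ?_⟩
  ext ζ
  simp only [mul_one, and_self, mem_filter, mem_univ, true_and, mem_singleton]
  constructor
  · intro h
    refine card_support_le_one.1 ((card_le_card h.1).trans_eq (card_singleton p))
  · rintro rfl
    exact ⟨by simp, by rw [cycleCount_one, card_singleton]⟩

/-- Every odd permutation of an `(m + 2)`-element set is in exactly `2 * m!` ways a product of a
full cycle and a full cycle on the complement of a point. -/
theorem nearFullCycleFactorizations_of_sign {m : ℕ} (hs : #s = m + 2) (hw : w.support ⊆ s)
    (hsign : sign w = -1) : nearFullCycleFactorizations s w = 2 * m.factorial := by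
  induction m generalizing s w with
  | zero =>
    have hw2 : #w.support = 2 := by
      refine le_antisymm ((card_le_card hw).trans_eq hs) (two_le_card_support_of_ne_one ?_)
      rintro rfl
      simp at hsign
    obtain ⟨x, y, hxy, rfl⟩ := card_support_eq_two.1 hw2
    have hsxy : s = {x, y} := by
      rw [← support_swap hxy]
      exact (eq_of_subset_of_card_le hw (by omega)).symm
    have hx : s.erase x = {y} := by rw [hsxy]; grind
    have hy : s.erase y = {x} := by rw [hsxy]; grind
    rw [nearFullCycleFactorizations, hsxy, sum_pair hxy, ← hsxy, hx, hy]
    simp [hxy, hxy.symm, deletePoint, swap_comm y x, fullCycleFactorizations_singleton_one]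
  | succ m ih =>
    obtain ⟨i, hi⟩ : ∃ i, w i ≠ i := by
      by_contra! h
      rw [show w = 1 from Equiv.ext h] at hsign
      simp at hsign
    have his : i ∈ s := hw (mem_support.2 hi)
    have hns := apply_mem_of_support_subset hw his
    have hcard := card_erase_add_one hns
    have hiS : i ∈ s.erase (w i) := mem_erase.2 ⟨hi.symm, his⟩
    have hcard' := card_erase_add_one hiS
    have hwn : w i ≠ w (w i) := fun h => hi (w.injective h).symm
    rw [nearFullCycleFactorizations_eq_sum (by omega) hw hns rfl hi.symm,
      sum_congr rfl (g := fun _ => 2 * m.factorial), sum_const, smul_eq_mul,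
      show #((s.erase (w i)).erase i) = m + 1 by omega, Nat.factorial_succ]
    · ring
    · intro j hj
      obtain ⟨hji, hjS⟩ := mem_erase.1 hj
      refine ih (by omega) (support_mul_subset (support_deletePoint_subset hw hns)
        (support_swap_subset hiS hjS)) ?_
      rw [deletePoint, Perm.sign_mul, Perm.sign_mul, sign_swap hji.symm, sign_swap hwn, hsign]
      simp

end FullCycle

section Counting

variable {α β : Type*} [Fintype α] [DecidableEq α] [Fintype β] [DecidableEq β]

theorem one_le_cycleCount [Nonempty α] (σ : Perm α) : 1 ≤ cycleCount σ := by
  have := card_lt_cycleCount_add_card univ_nonempty (subset_univ σ.support)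
  rw [card_univ] at this
  omega

theorem isFullCycleOn_univ {σ : Perm α} : IsFullCycleOn univ σ ↔ cycleCount σ = 1 := by
  rw [IsFullCycleOn, card_univ]
  have := subset_univ σ.support
  constructor
  · rintro ⟨-, h⟩
    omega
  · intro h
    exact ⟨this, by omega⟩

theorem cycleCount_swap_none_mul_optionCongr (a : α) (σ : Perm α) :
    cycleCount (swap none (some a) * optionCongr σ) = cycleCount σ := by
  have h : (swap none (some a) * optionCongr σ) none = some a := by simp
  have := cycleCount_swap_mul (σ := swap none (some a) * optionCongr σ) (x := none) (by simp [h])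
  rw [h, swap_mul_self_mul, cycleCount_optionCongr] at this
  omega

theorem card_filter_perm_option (P : Perm (Option α) → Prop) [DecidablePred P] :
    #{σ | P σ} = #{σ : Perm α | P (optionCongr σ)} +
      ∑ a : α, #{σ : Perm α | P (swap none (some a) * optionCongr σ)} := by
  have h : #{σ | P σ} =
      #{x : Option α × Perm α | P (swap none x.1 * optionCongr x.2)} := by
    refine (card_equiv Perm.decomposeOption.symm fun x => ?_).symm
    simp [Perm.decomposeOption]
  simp only [h, card_filter, Fintype.sum_prod_type, Fintype.sum_option, swap_self]
  rfl

theorem card_cycleCount_eq_of_equiv (e : α ≃ β) (k : ℕ) :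
    #{σ : Perm α | cycleCount σ = k} = #{σ : Perm β | cycleCount σ = k} :=
  card_equiv e.permCongr fun σ => by simp [cycleCount_permCongr]

theorem card_perm_fin_cycleCount_eq (n k : ℕ) :
    #{σ : Perm (Fin n) | cycleCount σ = k} = n.stirlingFirst k := by
  induction n generalizing k with
  | zero =>
    have h : ∀ σ : Perm (Fin 0), cycleCount σ = 0 := fun σ => by
      rw [Subsingleton.elim σ 1, cycleCount_one, Fintype.card_fin]
    cases k <;> simp [h]
  | succ n ih =>
    rw [card_cycleCount_eq_of_equiv (finSuccEquiv n), card_filter_perm_option]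
    simp only [cycleCount_optionCongr, cycleCount_swap_none_mul_optionCongr, sum_const, card_univ,
      ih, Fintype.card_fin, smul_eq_mul]
    cases k with
    | zero => cases n <;> simp
    | succ k =>
      simp only [Nat.add_right_cancel_iff]
      rw [ih, Nat.stirlingFirst_succ_succ, add_comm]

theorem card_cycleCount_eq (k : ℕ) :
    #{σ : Perm α | cycleCount σ = k} = (Fintype.card α).stirlingFirst k := by
  rw [card_cycleCount_eq_of_equiv (Fintype.equivFin α), card_perm_fin_cycleCount_eq]

theorem card_cycleCount_mul_optionCongr [Nonempty α] (η : Perm α) (k : ℕ) :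
    #{ζ : Perm (Option α) | cycleCount ζ = 1 ∧ cycleCount (ζ * optionCongr η) = k} =
      Fintype.card α * #{ζ : Perm α | cycleCount ζ = 1 ∧ cycleCount (ζ * η) = k} := by
  have hmul (ζ : Perm α) : optionCongr ζ * optionCongr η = optionCongr (ζ * η) := by
    ext1 x
    cases x <;> rfl
  have hne (ζ : Perm α) : cycleCount ζ ≠ 0 := Nat.one_le_iff_ne_zero.1 (one_le_cycleCount ζ)
  rw [card_filter_perm_option]
  simp [mul_assoc, hmul, cycleCount_swap_none_mul_optionCongr, cycleCount_optionCongr, hne]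

theorem isConj_of_cycleCount_eq_one {σ τ : Perm α} (hσ : cycleCount σ = 1)
    (hτ : cycleCount τ = 1) : IsConj σ τ := by
  have key (σ : Perm α) (hσ : cycleCount σ = 1) :
      σ = 1 ∧ Fintype.card α = 1 ∨ σ.cycleType = {Fintype.card α} ∧ σ ≠ 1 := by
    have h := cycleCount_add_card_support σ
    have h' := card_le_univ σ.support
    by_cases h1 : σ = 1
    · rw [h1, cycleCount_one] at hσ
      exact Or.inl ⟨h1, hσ⟩
    · have h2 := card_cycleType_pos.2 h1
      obtain ⟨a, ha⟩ := Multiset.card_eq_one.1 (show σ.cycleType.card = 1 by omega)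
      have h3 := sum_cycleType σ
      rw [ha, Multiset.sum_singleton] at h3
      rw [ha, Multiset.card_singleton] at h
      exact Or.inr ⟨by rw [ha, show a = Fintype.card α by omega], h1⟩
  have hcard {σ : Perm α} (h1 : Fintype.card α = 1) : σ = 1 := by
    have := Fintype.card_le_one_iff_subsingleton.1 h1.le
    exact Subsingleton.elim _ _
  rcases key σ hσ with h | h
  · rw [h.1, hcard (σ := τ) h.2]
  · rcases key τ hτ with h' | h'
    · exact absurd (hcard h'.2) h.2
    · exact isConj_of_cycleType_eq (h.1.trans h'.1.symm)

theorem card_cycleCount_mul_eq_of_isConj {η η' : Perm α} (h : IsConj η η') (k : ℕ) :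
    #{ζ : Perm α | cycleCount ζ = 1 ∧ cycleCount (ζ * η) = k} =
      #{ζ : Perm α | cycleCount ζ = 1 ∧ cycleCount (ζ * η') = k} := by
  obtain ⟨τ, rfl⟩ := isConj_iff.1 h
  refine card_equiv (MulAut.conj τ).toEquiv fun ζ => ?_
  simp only [mem_filter, mem_univ, true_and, MulEquiv.toEquiv_eq_coe, EquivLike.coe_coe,
    MulAut.conj_apply, cycleCount_conj]
  rw [show τ * ζ * τ⁻¹ * (τ * η * τ⁻¹) = τ * (ζ * η) * τ⁻¹ by group, cycleCount_conj]

theorem card_pairs_eq_of_erase (p q : α) (k : ℕ) :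
    #{x : Perm α × Perm α | cycleCount x.1 = 1 ∧ IsFullCycleOn (univ.erase p) x.2 ∧
        cycleCount (x.1 * x.2) = k} =
      #{x : Perm α × Perm α | cycleCount x.1 = 1 ∧ IsFullCycleOn (univ.erase q) x.2 ∧
        cycleCount (x.1 * x.2) = k} := by
  let c : Perm α ≃ Perm α := (MulAut.conj (swap q p)).toEquiv
  have hc (σ : Perm α) : c σ = swap q p * σ * (swap q p)⁻¹ := rfl
  have hinv : (swap q p)⁻¹ = swap q p := swap_inv q p
  refine card_equiv (c.prodCongr c) fun x => ?_
  have hmul : c x.1 * c x.2 = c (x.1 * x.2) := (map_mul (MulAut.conj (swap q p)) _ _).symm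
  have hfull : IsFullCycleOn (univ.erase p) x.2 ↔ IsFullCycleOn (univ.erase q) (c x.2) := by
    constructor
    · intro h
      have := h.conj (swap q p)
      rwa [map_swap_erase (mem_univ q) (mem_univ p)] at this
    · intro h
      have := h.conj (swap p q)
      rw [map_swap_erase (mem_univ p) (mem_univ q), hc, hinv, swap_comm p q, hinv] at this
      simpa [mul_assoc] using this
  simp only [mem_filter, mem_univ, true_and, prodCongr_apply, Prod.map_fst, Prod.map_snd, hmul,
    ← hfull]
  rw [hc, hc, cycleCount_conj, cycleCount_conj]

theorem sum_nearFullCycleFactorizations [Nontrivial α] (p : α) (k : ℕ) :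
    ∑ w : Perm α with cycleCount w = k, nearFullCycleFactorizations univ w =
      Fintype.card α *
        #{x : Perm α × Perm α | cycleCount x.1 = 1 ∧ IsFullCycleOn (univ.erase p) x.2 ∧
          cycleCount (x.1 * x.2) = k} := by
  have hcard : 2 ≤ #(univ : Finset α) := Fintype.one_lt_card
  simp only [nearFullCycleFactorizations,
    ← card_isFullCycleOn_erase hcard (subset_univ (Perm.support _)) (mem_univ _)]
  rw [sum_comm, sum_congr rfl (g := fun _ => _), sum_const, card_univ, smul_eq_mul]
  intro q _
  rw [← card_pairs_eq_of_erase q p k, ← card_sigma]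
  refine card_nbij' (fun x => (x.2⁻¹, x.2 * x.1)) (fun x => ⟨x.1 * x.2, x.1⁻¹⟩) ?_ ?_ ?_ ?_
  · rintro ⟨w, ζ⟩ h
    simp only [coe_sigma, Set.mem_sigma_iff, coe_filter, mem_univ, true_and, Set.mem_ofPred_eq,
      isFullCycleOn_univ] at h ⊢
    exact ⟨by rw [cycleCount_inv]; exact h.2.1, h.2.2, by simpa using h.1⟩
  · rintro ⟨ζ, η⟩ h
    simp only [coe_sigma, Set.mem_sigma_iff, coe_filter, mem_univ, true_and, Set.mem_ofPred_eq,
      isFullCycleOn_univ] at h ⊢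
    exact ⟨h.2.2, by rw [cycleCount_inv]; exact h.1, by simpa using h.2.1⟩
  · rintro ⟨w, ζ⟩ _
    simp
  · rintro ⟨ζ, η⟩ _
    simp

theorem isFullCycleOn_erase_none {η : Perm (Option α)} :
    IsFullCycleOn (univ.erase none) η ↔ ∃ σ : Perm α, cycleCount σ = 1 ∧ optionCongr σ = η := by
  have hcard : #((univ : Finset (Option α)).erase none) = Fintype.card α := by
    simp
  constructor
  · rintro ⟨h₁, h₂⟩
    have hnone : η none = none := by
      by_contra h
      exact notMem_erase none univ (h₁ (mem_support.2 h))
    have hη : optionCongr (removeNone η) = η := by simp [hnone, ← Perm.one_def]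
    refine ⟨removeNone η, ?_, hη⟩
    rw [← hη, cycleCount_optionCongr, hcard, Fintype.card_option] at h₂
    omega
  · rintro ⟨σ, hσ, rfl⟩
    refine ⟨support_subset_erase (subset_univ _) rfl, ?_⟩
    rw [cycleCount_optionCongr, hcard, Fintype.card_option]
    omega

theorem card_pairs_erase_none [Nonempty α] {ρ : Perm α} (hρ : cycleCount ρ = 1) (k : ℕ) :
    #{x : Perm (Option α) × Perm (Option α) | cycleCount x.1 = 1 ∧
        IsFullCycleOn (univ.erase none) x.2 ∧ cycleCount (x.1 * x.2) = k} =
      (Fintype.card α).factorial *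
        #{ζ : Perm α | cycleCount ζ = 1 ∧ cycleCount (ζ * ρ) = k} := by
  have h : #{x : Perm (Option α) × Perm (Option α) | cycleCount x.1 = 1 ∧
        IsFullCycleOn (univ.erase none) x.2 ∧ cycleCount (x.1 * x.2) = k} =
      ∑ η : Perm α with cycleCount η = 1,
        #{ζ : Perm (Option α) | cycleCount ζ = 1 ∧ cycleCount (ζ * optionCongr η) = k} := by
    rw [← card_sigma]
    symm
    refine card_nbij (fun x => (x.2, optionCongr x.1)) ?_ ?_ ?_
    · rintro ⟨η, ζ⟩ h
      simp only [coe_sigma, Set.mem_sigma_iff, coe_filter, mem_univ, true_and,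
        Set.mem_ofPred_eq] at h ⊢
      exact ⟨h.2.1, isFullCycleOn_erase_none.2 ⟨η, h.1, rfl⟩, h.2.2⟩
    · rintro ⟨η, ζ⟩ _ ⟨η', ζ'⟩ _ h
      obtain ⟨rfl, h⟩ := Prod.mk.inj h
      obtain rfl := optionCongr_injective h
      rfl
    · rintro ⟨ζ, η⟩ h
      simp only [coe_filter, mem_univ, true_and, Set.mem_ofPred_eq] at h
      obtain ⟨σ, hσ, rfl⟩ := isFullCycleOn_erase_none.1 h.2.1
      refine ⟨⟨σ, ζ⟩, ?_, rfl⟩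
      simp only [coe_sigma, Set.mem_sigma_iff, coe_filter, mem_univ, true_and,
        Set.mem_ofPred_eq]
      exact ⟨hσ, h.1, h.2.2⟩
  obtain ⟨n, hn⟩ := Nat.exists_eq_succ_of_ne_zero (Fintype.card_ne_zero (α := α))
  rw [h, sum_congr rfl (g := fun _ => Fintype.card α *
    #{ζ : Perm α | cycleCount ζ = 1 ∧ cycleCount (ζ * ρ) = k}), sum_const, card_cycleCount_eq, hn,
    Nat.succ_eq_add_one, Nat.stirlingFirst_one_right, Nat.factorial_succ, smul_eq_mul]
  · ring
  · intro η hη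
    rw [card_cycleCount_mul_optionCongr, card_cycleCount_mul_eq_of_isConj
      (isConj_of_cycleCount_eq_one (mem_filter.1 hη).2 hρ)]

/-- Zagier's formula: the number of full cycles `ζ` on `N` points such that `ζ * ρ` has `k` cycles
is `2 / (N * (N + 1))` times an unsigned Stirling number of the first kind. -/
theorem card_mul_card_cycleCount_mul_eq [Nonempty α] {ρ : Perm α} (hρ : cycleCount ρ = 1) {k : ℕ}
    (hk : Even (Fintype.card α + k)) :
    (Fintype.card α + 1) * Fintype.card α *
        #{ζ : Perm α | cycleCount ζ = 1 ∧ cycleCount (ζ * ρ) = k} =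
      2 * (Fintype.card α + 1).stirlingFirst k := by
  obtain ⟨n, hn⟩ := Nat.exists_eq_succ_of_ne_zero (Fintype.card_ne_zero (α := α))
  have h := sum_nearFullCycleFactorizations (none : Option α) k
  rw [sum_congr rfl (g := fun _ => 2 * n.factorial), sum_const, card_cycleCount_eq,
    card_pairs_erase_none hρ, Fintype.card_option, smul_eq_mul, hn, Nat.factorial_succ] at h
  · refine Nat.eq_of_mul_eq_mul_right n.factorial_pos ?_
    rw [hn]
    linarith
  · intro w hw
    refine nearFullCycleFactorizations_of_sign ?_ (subset_univ _) ?_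
    · rw [card_univ, Fintype.card_option, hn]
    · rw [sign_eq_neg_one_pow, Fintype.card_option, (mem_filter.1 hw).2]
      exact Odd.neg_one_pow (by rw [add_right_comm]; exact hk.add_one)

theorem cycleCount_finRotate (n : ℕ) : cycleCount (finRotate (n + 1)) = 1 := by
  cases n with
  | zero =>
    change cycleCount (finRotate 1) = 1
    rw [Subsingleton.elim (finRotate 1) 1, cycleCount_one, Fintype.card_fin]
  | succ n =>
    change cycleCount (finRotate (n + 2)) = 1
    have := cycleCount_add_card_support (finRotate (n + 2))
    rw [support_finRotate, cycleType_finRotate, card_univ, Fintype.card_fin,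
      Multiset.card_singleton] at this
    omega

end Counting

theorem mul_hultman (n : ℕ) (g : ℤ) (k : ℕ) (hk : (k : ℤ) = n + 1 - 2 * g) :
    (n + 2) * (n + 1) * hultman n g = 2 * (n + 2).stirlingFirst k := by
  have h := card_mul_card_cycleCount_mul_eq (cycleCount_finRotate n) (k := k)
    (by rw [Fintype.card_fin]; exact (Int.even_coe_nat _).1 ⟨n + 1 - g, by push_cast; omega⟩)
  rw [Fintype.card_fin] at h
  rw [hultman, ← h]
  simp only [← hk, Nat.cast_inj]

theorem hultman_eq_zero (n : ℕ) (g : ℤ) (h : (n : ℤ) + 1 < 2 * g) : hultman n g = 0 := by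
  refine card_eq_zero.2 (filter_eq_empty_iff.2 fun ζ _ hζ => ?_)
  have := hζ.2
  omega

/-- The Alexeev–Zograf recurrence for Hultman numbers:
`(n+2)·h_g(n) + (n-1)·h_g(n-2) = (2n+1)·h_g(n-1) + n²(n-1)·h_{g-1}(n-2)`. -/
theorem stmt_15 (n : ℕ) (g : ℕ) (hn : 2 ≤ n) :
    (n + 2) * hultman n g + (n - 1) * hultman (n - 2) g =
      (2 * n + 1) * hultman (n - 1) g + n ^ 2 * (n - 1) * hultman (n - 2) ((g : ℤ) - 1) := by
  obtain ⟨m, rfl⟩ := Nat.exists_eq_add_of_le' hn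
  have e₁ : m + 2 - 1 = m + 1 := rfl
  have e₂ : m + 2 - 2 = m := rfl
  rw [e₁, e₂]
  rcases lt_or_ge ((m : ℤ) + 3) (2 * g) with hlt | hge
  · rw [hultman_eq_zero (m + 2) g (by push_cast; omega), hultman_eq_zero m g (by omega),
      hultman_eq_zero (m + 1) g (by push_cast; omega), hultman_eq_zero m (g - 1) (by omega)]
    ring
  obtain ⟨k, hk⟩ := Int.eq_ofNat_of_zero_le (show 0 ≤ (m : ℤ) + 3 - 2 * g by omega)
  have h₀ := mul_hultman (m + 2) g k (by push_cast; omega)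
  have h₃ := mul_hultman m (g - 1) k (by omega)
  refine Nat.eq_of_mul_eq_mul_left (show 0 < (m + 2) * (m + 3) by positivity) ?_
  match k with
  | 0 =>
    rw [Nat.stirlingFirst_succ_zero] at h₀ h₃
    rw [hultman_eq_zero m g (by omega), hultman_eq_zero (m + 1) g (by push_cast; omega)]
    simp only [mul_zero, mul_eq_zero] at h₀ h₃
    grind
  | 1 =>
    have h₁ := mul_hultman (m + 1) g 0 (by push_cast; omega)
    rw [hultman_eq_zero m g (by omega)]
    simp only [Nat.stirlingFirst_succ_succ, Nat.stirlingFirst_succ_zero] at h₀ h₁ h₃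
    zify at *
    linear_combination (m + 2 : ℤ) * h₀ - (2 * m + 5 : ℤ) * h₁ - (m + 3) * (m + 2) ^ 2 * h₃
  | k + 2 =>
    have h₁ := mul_hultman (m + 1) g (k + 1) (by push_cast at *; omega)
    have h₂ := mul_hultman m g k (by push_cast at *; omega)
    rw [Nat.stirlingFirst_succ_succ (m + 3), Nat.stirlingFirst_succ_succ (m + 2),
      Nat.stirlingFirst_succ_succ (m + 2) k] at h₀
    rw [Nat.stirlingFirst_succ_succ (m + 2)] at h₁
    zify at *
    linear_combination (m + 2 : ℤ) * h₀ + (m + 3 : ℤ) * h₂ - (2 * m + 5 : ℤ) * h₁ -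
      (m + 3) * (m + 2) ^ 2 * h₃
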